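/- arXiv:2202.12001 — 5 statements merged into one kernel-verified Lean document; each statement's English description precedes it below -/
import Mathlib

section
/- Let p be a prime and r ≥ 1 an integer. For every g ∈ GL₂(ℚ_p) there exist λ ∈ ℚ_p^× which is an integer power of p, and t ∈ Γ₀(p^r ℤ_p), such that λ·g·t has all four entries in ℤ_p and at least one entry in ℤ_p^× (i.e., the minimum of the p-adic valuations of its entries is 0). Moreover, when r = 1 one can choose λ and t so that all four entries of λ·g·t lie in the image of ℤ in ℤ_p. (The quotient GL₂(ℚ_p)/ℚ_p^× Γ₀(p^r ℤ_p) admits a set of coset representatives with coefficients in ℤ_p, and with coefficients in ℤ when r = 1.) -/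
open Matrix

/-- A matrix over `ℚ_p` lies in `Γ₀(p^r ℤ_p)`: all entries in `ℤ_p`, determinant a unit,
and lower-left entry in `p^r ℤ_p`. -/
def Gamma0 (p : ℕ) [Fact p.Prime] (r : ℕ) (M : Matrix (Fin 2) (Fin 2) ℚ_[p]) : Prop :=
  (∀ i j, ‖M i j‖ ≤ 1) ∧ ‖M.det‖ = 1 ∧ ‖M 1 0‖ ≤ (p : ℝ) ^ (-(r : ℤ))

section PadicApproximation

variable {p : ℕ} [Fact p.Prime]

theorem Padic.exists_int_norm_sub_lt {x : ℚ_[p]} (hx : ‖x‖ ≤ 1) {ε : ℝ} (hε : 0 < ε) :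
    ∃ z : ℤ, ‖(z : ℚ_[p]) - x‖ < ε := by
  obtain ⟨x, rfl⟩ : ∃ y : ℤ_[p], (y : ℚ_[p]) = x := ⟨⟨x, hx⟩, rfl⟩
  obtain ⟨z, hz⟩ := PadicInt.denseRange_intCast.exists_dist_lt x hε
  refine ⟨z, ?_⟩
  rw [dist_comm, dist_eq_norm, PadicInt.norm_def] at hz
  simpa using hz

theorem Padic.norm_add_le_of_le {x y : ℚ_[p]} {ε : ℝ} (hx : ‖x‖ ≤ ε) (hy : ‖y‖ ≤ ε) :
    ‖x + y‖ ≤ ε :=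
  (Padic.nonarchimedean x y).trans (max_le hx hy)

theorem Padic.norm_eq_one_of_norm_sub_lt_one {x y : ℚ_[p]} (hy : ‖y‖ = 1) (h : ‖x - y‖ < 1) :
    ‖x‖ = 1 := by
  have := Padic.add_eq_max_of_ne (p := p) (q := x - y) (r := y) (by rw [hy]; exact h.ne)
  rwa [sub_add_cancel, hy, max_eq_right h.le] at this

/-- A nonzero matrix over `ℚ_p` can be scaled by a power of `p` to be integral with a unit entry. -/
theorem Padic.exists_zpow_smul_matrix_primitive {m n : Type*} [Finite m] [Finite n]
    {g : Matrix m n ℚ_[p]} (hg : g ≠ 0) :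
    ∃ s : ℤ, (∀ i j, ‖((p : ℚ_[p]) ^ s • g) i j‖ ≤ 1) ∧
      ∃ i j, ‖((p : ℚ_[p]) ^ s • g) i j‖ = 1 := by
  obtain ⟨i₀, j₀, h₀⟩ : ∃ i j, g i j ≠ 0 := by
    by_contra! h
    exact hg (Matrix.ext h)
  have : Nonempty (m × n) := ⟨(i₀, j₀)⟩
  obtain ⟨⟨i, j⟩, hmax⟩ := Finite.exists_max fun k : m × n => ‖g k.1 k.2‖
  have hpos : 0 < ‖g i j‖ := (norm_pos_iff.2 h₀).trans_le (hmax (i₀, j₀))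
  have hscale : ‖(p : ℚ_[p]) ^ (-(g i j).valuation)‖ = ‖g i j‖⁻¹ := by
    rw [Padic.norm_p_zpow, Padic.norm_eq_zpow_neg_valuation (norm_pos_iff.1 hpos), ← _root_.zpow_neg]
  refine ⟨-(g i j).valuation, fun k l => ?_, i, j, ?_⟩
  · rw [Matrix.smul_apply, smul_eq_mul, norm_mul, hscale]
    exact inv_mul_le_one_of_le₀ (hmax (k, l)) hpos.le
  · rw [Matrix.smul_apply, smul_eq_mul, norm_mul, hscale, inv_mul_cancel₀ hpos.ne']

theorem Padic.norm_adjugate_mul_fin_two_le {h D : Matrix (Fin 2) (Fin 2) ℚ_[p]} {ε : ℝ}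
    (hh : ∀ i j, ‖h i j‖ ≤ 1) (hD : ∀ i j, ‖D i j‖ ≤ ε) (i j : Fin 2) :
    ‖(h.adjugate * D) i j‖ ≤ ε := by
  have hadj : ∀ i j, ‖h.adjugate i j‖ ≤ 1 := by
    intro i j
    rw [Matrix.adjugate_fin_two]
    fin_cases i <;> fin_cases j <;> simp [hh]
  have hmul : ∀ k, ‖h.adjugate i k * D k j‖ ≤ ε := fun k => by
    rw [norm_mul]
    exact (mul_le_of_le_one_left (norm_nonneg _) (hadj i k)).trans (hD k j)
  rw [Matrix.mul_apply, Fin.sum_univ_two]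
  exact Padic.norm_add_le_of_le (hmul 0) (hmul 1)

/-- The principal congruence subgroup of level `p ^ r` is contained in `Γ₀(p^r ℤ_p)`. -/
theorem gamma0_one_add {r : ℕ} (hr : 1 ≤ r) {E : Matrix (Fin 2) (Fin 2) ℚ_[p]}
    (hE : ∀ i j, ‖E i j‖ ≤ (p : ℝ) ^ (-(r : ℤ))) : Gamma0 p r (1 + E) := by
  have hp : (1 : ℝ) < p := mod_cast (Fact.out : p.Prime).one_lt
  have hlt : (p : ℝ) ^ (-(r : ℤ)) < 1 := zpow_lt_one_of_neg₀ hp (by omega)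
  have hE1 : ∀ i j, ‖E i j‖ ≤ 1 := fun i j => (hE i j).trans hlt.le
  refine ⟨fun i j => ?_, ?_, ?_⟩
  · rw [Matrix.add_apply]
    refine Padic.norm_add_le_of_le ?_ (hE1 i j)
    rw [Matrix.one_apply]
    split_ifs <;> simp
  · refine Padic.norm_eq_one_of_norm_sub_lt_one (y := 1) norm_one (lt_of_le_of_lt ?_ hlt)
    have hdet : (1 + E).det - 1 =
        E 0 0 + (E 1 1 + (E 0 0 * E 1 1 + -(E 0 1 * E 1 0))) := by
      rw [Matrix.det_fin_two]
      simp
      ring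
    have hmul : ∀ i j k l, ‖E i j * E k l‖ ≤ (p : ℝ) ^ (-(r : ℤ)) := fun i j k l => by
      rw [norm_mul]
      exact (mul_le_of_le_one_left (norm_nonneg _) (hE1 i j)).trans (hE k l)
    rw [hdet]
    exact Padic.norm_add_le_of_le (hE 0 0) <| Padic.norm_add_le_of_le (hE 1 1) <|
      Padic.norm_add_le_of_le (hmul 0 0 1 1) ((norm_neg _).trans_le (hmul 0 1 1 0))
  · simpa using hE 1 0

end PadicApproximation

/-- every class in `GL₂(ℚ_p)/ℚ_p^× Γ₀(p^r ℤ_p)` has a representative with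
entries in `ℤ_p` and at least one entry a unit; for `r = 1` the representative may be
chosen with entries in the image of `ℤ`. -/
theorem coset_representatives_integral (p : ℕ) [Fact p.Prime] (r : ℕ) (hr : 1 ≤ r)
    (g : Matrix (Fin 2) (Fin 2) ℚ_[p]) (hg : g.det ≠ 0) :
    ∃ (s : ℤ) (t : Matrix (Fin 2) (Fin 2) ℚ_[p]), Gamma0 p r t ∧
      (∀ i j, ‖((p : ℚ_[p]) ^ s • (g * t)) i j‖ ≤ 1) ∧
      (∃ i j, ‖((p : ℚ_[p]) ^ s • (g * t)) i j‖ = 1) ∧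
      (r = 1 → ∀ i j, ∃ z : ℤ, ((p : ℚ_[p]) ^ s • (g * t)) i j = (z : ℚ_[p])) := by
  have hp : (1 : ℝ) < p := mod_cast (Fact.out : p.Prime).one_lt
  have hp0 : (p : ℚ_[p]) ≠ 0 := mod_cast (Fact.out : p.Prime).ne_zero
  obtain ⟨s, hint, i₀, j₀, hunit⟩ := Padic.exists_zpow_smul_matrix_primitive (g := g) <| by
    rintro rfl
    simp at hg
  set h := (p : ℚ_[p]) ^ s • g with hh
  have hd : h.det ≠ 0 := by
    rw [hh, Matrix.det_smul]
    exact mul_ne_zero (pow_ne_zero _ (zpow_ne_zero _ hp0)) hg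
  have hδ : 0 < (p : ℝ) ^ (-(r : ℤ)) := zpow_pos (by linarith) _
  have hε : 0 < min 1 (‖h.det‖ * (p : ℝ) ^ (-(r : ℤ))) :=
    lt_min one_pos (mul_pos (norm_pos_iff.2 hd) hδ)
  choose z hz using fun i j => Padic.exists_int_norm_sub_lt (hint i j) hε
  set A : Matrix (Fin 2) (Fin 2) ℚ_[p] := Matrix.of fun i j => (z i j : ℚ_[p]) with hA
  have hprod : (p : ℚ_[p]) ^ s • (g * (1 + h.det⁻¹ • (h.adjugate * (A - h)))) = A := by
    rw [← Matrix.smul_mul, ← hh, mul_add, mul_one, Matrix.mul_smul, ← mul_assoc,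
      Matrix.mul_adjugate, Matrix.smul_mul, one_mul, smul_smul, inv_mul_cancel₀ hd, one_smul,
      add_sub_cancel]
  refine ⟨s, 1 + h.det⁻¹ • (h.adjugate * (A - h)), gamma0_one_add hr fun i j => ?_, ?_⟩
  · rw [Matrix.smul_apply, smul_eq_mul, norm_mul, norm_inv,
      inv_mul_le_iff₀ (norm_pos_iff.2 hd)]
    exact Padic.norm_adjugate_mul_fin_two_le hint
      (fun i j => ((hz i j).trans_le (min_le_right _ _)).le) i j
  · rw [hprod]
    exact ⟨fun i j => Padic.norm_int_le_one (z i j),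
      ⟨i₀, j₀, Padic.norm_eq_one_of_norm_sub_lt_one hunit ((hz i₀ j₀).trans_le (min_le_left _ _))⟩,
      fun _ i j => ⟨z i j, rfl⟩⟩
end

section
/- Let p be a prime and r ≥ 1 an integer. Let M = [[a, b],[c, d]] ∈ GL₂(ℚ_p) have all entries in ℤ_p with min{v_p(a), v_p(b), v_p(c), v_p(d)} = 0, and set N = v_p(det M). If v_p(a) ≤ v_p(b), then there exist t ∈ Γ₀(p^r ℤ_p) and an integer c′ with 0 < c′ ≤ p^{r+N−v_p(a)} such that M·t = [[p^{v_p(a)}, 0],[c′, p^{N−v_p(a)}]]. -/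
open Matrix Classical

/-- The `p`-adic valuation on `ℚ_p` with the convention `v_p(0) = +∞`. -/
noncomputable def vp (p : ℕ) [Fact p.Prime] (x : ℚ_[p]) : WithTop ℤ :=
  if x = 0 then ⊤ else (x.valuation : WithTop ℤ)

/-- Every `p`-adic integer is congruent modulo `p ^ k` to an integer in `(0, p ^ k]`. -/
theorem Padic.exists_nat_eq_add_pow_mul (p : ℕ) [Fact p.Prime] (k : ℕ) (x : ℤ_[p]) :
    ∃ n : ℕ, 0 < n ∧ n ≤ p ^ k ∧ ∃ s : ℚ_[p], ‖s‖ ≤ 1 ∧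
      (n : ℚ_[p]) = (x : ℚ_[p]) + (p : ℚ_[p]) ^ k * s := by
  have hp : 0 < p := (Fact.out : p.Prime).pos
  obtain ⟨y, hy⟩ := Ideal.mem_span_singleton'.1 (PadicInt.appr_spec k x)
  have hxy : (y : ℚ_[p]) * (p : ℚ_[p]) ^ k = x - ((PadicInt.appr x k : ℕ) : ℚ_[p]) := by
    exact_mod_cast congrArg ((↑) : ℤ_[p] → ℚ_[p]) hy
  rcases Nat.eq_zero_or_pos (PadicInt.appr x k) with h0 | h0
  · refine ⟨p ^ k, pow_pos hp k, le_rfl, ((1 - y : ℤ_[p]) : ℚ_[p]), PadicInt.norm_le_one _, ?_⟩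
    rw [h0] at hxy
    push_cast at hxy ⊢
    linear_combination hxy
  · refine ⟨_, h0, (PadicInt.appr_lt x k).le, ((-y : ℤ_[p]) : ℚ_[p]),
      PadicInt.norm_le_one _, ?_⟩
    push_cast
    linear_combination hxy

/-- Dividing a nonzero `p`-adic number by its power of `p` leaves a unit. -/
theorem Padic.norm_div_zpow_valuation (p : ℕ) [Fact p.Prime] {x : ℚ_[p]} (hx : x ≠ 0) :
    ‖x / (p : ℚ_[p]) ^ x.valuation‖ = 1 := by
  have hp : (p : ℝ) ≠ 0 := Nat.cast_ne_zero.2 (Fact.out : p.Prime).ne_zero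
  rw [norm_div, Padic.norm_p_zpow, Padic.norm_eq_zpow_neg_valuation hx]
  exact div_self (zpow_ne_zero _ hp)

/-- the reduction algorithm, case `v_p(a) ≤ v_p(b)`. -/
theorem reduction_case_a_le_b (p : ℕ) [Fact p.Prime] (r : ℕ) (hr : 1 ≤ r)
    (a b c d : ℚ_[p]) (M : Matrix (Fin 2) (Fin 2) ℚ_[p]) (hM : M = !![a, b; c, d])
    (hdet : M.det ≠ 0)
    (hint : ∀ i j, ‖M i j‖ ≤ 1) (hmin : ∃ i j, ‖M i j‖ = 1)
    (N : ℤ) (hN : vp p M.det = (N : WithTop ℤ))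
    (hab : vp p a ≤ vp p b) :
    ∃ va : ℤ, vp p a = (va : WithTop ℤ) ∧
      ∃ t : Matrix (Fin 2) (Fin 2) ℚ_[p], Gamma0 p r t ∧
        ∃ c' : ℤ, 0 < c' ∧ (c' : ℚ) ≤ (p : ℚ) ^ ((r : ℤ) + N - va) ∧
          M * t = !![(p : ℚ_[p]) ^ va, 0; (c' : ℚ_[p]), (p : ℚ_[p]) ^ (N - va)] := by
  have hp0 : (p : ℚ_[p]) ≠ 0 := Nat.cast_ne_zero.2 (Fact.out : p.Prime).ne_zero
  have hp1 : (1 : ℝ) < p := Nat.one_lt_cast.2 (Fact.out : p.Prime).one_lt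
  subst hM
  have hD : (!![a, b; c, d] : Matrix (Fin 2) (Fin 2) ℚ_[p]).det = a * d - b * c :=
    Matrix.det_fin_two_of a b c d
  rw [hD] at hdet hN
  have ha : a ≠ 0 := by
    rintro rfl
    have hb : b = 0 := by
      by_contra hb
      simp [vp, hb] at hab
    simp [hb] at hdet
  have hc1 : ‖c‖ ≤ 1 := hint 1 0
  have hd1 : ‖d‖ ≤ 1 := hint 1 1
  have hNv : (a * d - b * c).valuation = N := by
    simpa [vp, hdet] using hN
  have hba : ‖b / a‖ ≤ 1 := by
    by_cases hb : b = 0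
    · simp [hb]
    · have hv : a.valuation ≤ b.valuation := by simpa [vp, ha, hb] using hab
      rw [norm_div, div_le_one (norm_pos_iff.2 ha), Padic.norm_eq_zpow_neg_valuation ha,
        Padic.norm_eq_zpow_neg_valuation hb]
      exact zpow_le_zpow_right₀ hp1.le (neg_le_neg hv)
  have hu := Padic.norm_div_zpow_valuation p ha
  have hw := Padic.norm_div_zpow_valuation p hdet
  rw [hNv] at hw
  set va := a.valuation with hva
  have hA : (p : ℚ_[p]) ^ va ≠ 0 := zpow_ne_zero _ hp0
  have hP : (p : ℚ_[p]) ^ N ≠ 0 := zpow_ne_zero _ hp0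
  have hNva : 0 ≤ N - va := by
    have h1 : ‖d - b / a * c‖ ≤ 1 := by
      rw [sub_eq_add_neg]
      refine (Padic.nonarchimedean _ _).trans ?_
      rw [norm_neg, norm_mul]
      exact max_le hd1 (mul_le_one₀ hba (norm_nonneg _) hc1)
    have h2 : d - b / a * c = (a * d - b * c) / a := by field_simp
    rw [h2, norm_div, Padic.norm_eq_zpow_neg_valuation ha, Padic.norm_eq_zpow_neg_valuation hdet,
      hNv, ← hva, ← zpow_sub₀ (by positivity), zpow_le_one_iff_right₀ hp1] at h1
    linarith
  obtain ⟨k, hk⟩ : ∃ k : ℕ, (k : ℤ) = r + N - va :=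
    ⟨(r + N - va).toNat, Int.toNat_of_nonneg (by omega)⟩
  set u := a / (p : ℚ_[p]) ^ va
  set w := (a * d - b * c) / (p : ℚ_[p]) ^ N
  have hu0 : u ≠ 0 := div_ne_zero ha hA
  have hw0 : w ≠ 0 := div_ne_zero hdet hP
  have hau : a = u * (p : ℚ_[p]) ^ va := (div_mul_cancel₀ _ hA).symm
  have hDw : a * d - b * c = w * (p : ℚ_[p]) ^ N := (div_mul_cancel₀ _ hP).symm
  obtain ⟨n, hn0, hnk, s, hs, hns⟩ :=
    Padic.exists_nat_eq_add_pow_mul p k ⟨c / u, by rwa [norm_div, hu, div_one]⟩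
  replace hns : (n : ℚ_[p]) = c / u + (p : ℚ_[p]) ^ k * s := hns
  have hpk : (p : ℚ_[p]) ^ k = (p : ℚ_[p]) ^ r * (p : ℚ_[p]) ^ N / (p : ℚ_[p]) ^ va := by
    rw [← zpow_natCast, hk, zpow_sub₀ hp0, zpow_add₀ hp0, zpow_natCast]
  have hq : ‖(p : ℚ_[p]) ^ r * s‖ ≤ (p : ℝ) ^ (-(r : ℤ)) := by
    rw [norm_mul, Padic.norm_p_pow]
    exact mul_le_of_le_one_right (by positivity) hs
  have hq1 : ‖(p : ℚ_[p]) ^ r * s‖ ≤ 1 :=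
    hq.trans ((zpow_le_one_iff_right₀ hp1).2 (by omega))
  have hb' : ‖b / a * (u / w)‖ ≤ 1 := by
    rwa [norm_mul, norm_div u, hu, hw, div_one, mul_one]
  have huw : ‖u / w‖ = 1 := by rw [norm_div, hu, hw, div_one]
  refine ⟨va, by simp [vp, ha, hva], !![u⁻¹ - b / a * (u / w) * ((p : ℚ_[p]) ^ r * s),
    -(b / a * (u / w)); u / w * ((p : ℚ_[p]) ^ r * s), u / w], ⟨?_, ?_, ?_⟩, n, ?_, ?_, ?_⟩
  · have h00 : ‖u⁻¹ - b / a * (u / w) * ((p : ℚ_[p]) ^ r * s)‖ ≤ 1 := by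
      rw [sub_eq_add_neg]
      refine (Padic.nonarchimedean _ _).trans (max_le (by rw [norm_inv, hu, inv_one]) ?_)
      rw [norm_neg, norm_mul]
      exact mul_le_one₀ hb' (norm_nonneg _) hq1
    have h10 : ‖u / w * ((p : ℚ_[p]) ^ r * s)‖ ≤ 1 := by rwa [norm_mul, huw, one_mul]
    intro i j
    fin_cases i <;> fin_cases j
    · exact h00
    · exact (norm_neg _).trans_le hb'
    · exact h10
    · exact huw.le
  · have : (u⁻¹ - b / a * (u / w) * ((p : ℚ_[p]) ^ r * s)) * (u / w) -
        -(b / a * (u / w)) * (u / w * ((p : ℚ_[p]) ^ r * s)) = w⁻¹ := by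
      field_simp
      ring
    rw [Matrix.det_fin_two_of, this, norm_inv, hw, inv_one]
  · change ‖u / w * ((p : ℚ_[p]) ^ r * s)‖ ≤ _
    rwa [norm_mul, huw, one_mul]
  · exact_mod_cast hn0
  · rw [← hk, zpow_natCast]
    exact_mod_cast hnk
  · have hdiag : (d - b / a * c) * (u / w) = (p : ℚ_[p]) ^ N / (p : ℚ_[p]) ^ va := by
      have h2 : d - b / a * c = w * (p : ℚ_[p]) ^ N / a := by
        rw [← hDw]
        field_simp
      rw [h2, hau]
      field_simp
    have hau' : a * u⁻¹ = (p : ℚ_[p]) ^ va := by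
      rw [hau]
      field_simp
    have hba' : a * (b / a) = b := mul_div_cancel₀ b ha
    rw [zpow_sub₀ hp0, Int.cast_natCast, hns, hpk]
    clear_value u w
    ext i j
    fin_cases i <;> fin_cases j <;> simp [Matrix.mul_apply, Fin.sum_univ_two]
    · linear_combination hau' - (u / w) * ((p : ℚ_[p]) ^ r * s) * hba'
    · linear_combination - (u / w) * hba'
    · linear_combination (p : ℚ_[p]) ^ r * s * hdiag
    · linear_combination hdiag
end

section
/- Let p be a prime and r ≥ 1 an integer. Let M = [[a, b],[c, d]] ∈ GL₂(ℚ_p) have all entries in ℤ_p with min{v_p(a), v_p(b), v_p(c), v_p(d)} = 0, and set N = v_p(det M). If v_p(a) ≥ v_p(b) + r, then there exist t ∈ Γ₀(p^r ℤ_p) and an integer d′ with 0 < d′ ≤ p^{N−v_p(b)} such that M·t = [[0, p^{v_p(b)}],[p^{N−v_p(b)}, d′]]. -/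
open Matrix Classical

theorem vp_eq_coe_iff {p : ℕ} [Fact p.Prime] {x : ℚ_[p]} {n : ℤ} :
    vp p x = (n : WithTop ℤ) ↔ x ≠ 0 ∧ x.valuation = n := by
  unfold vp
  split_ifs with h <;> simp [h]

theorem Padic.norm_sub_le_one {p : ℕ} [Fact p.Prime] {x y : ℚ_[p]} (hx : ‖x‖ ≤ 1) (hy : ‖y‖ ≤ 1) :
    ‖x - y‖ ≤ 1 := by
  rw [sub_eq_add_neg]
  exact (Padic.nonarchimedean _ _).trans (max_le hx (by rwa [norm_neg]))

theorem norm_div_le_of_vp_add_le {p : ℕ} [Fact p.Prime] {a b : ℚ_[p]} {r : ℤ} (hb : b ≠ 0)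
    (h : vp p b + (r : WithTop ℤ) ≤ vp p a) : ‖a / b‖ ≤ (p : ℝ) ^ (-r) := by
  have hp : (1 : ℝ) < p := mod_cast (Fact.out : p.Prime).one_lt
  by_cases ha : a = 0
  · simp only [ha, zero_div, norm_zero]
    positivity
  · simp only [vp, ha, hb, if_false] at h
    have h : b.valuation + r ≤ a.valuation := mod_cast h
    rw [norm_div, Padic.norm_eq_zpow_neg_valuation ha, Padic.norm_eq_zpow_neg_valuation hb,
      ← zpow_sub₀ (by positivity)]
    exact zpow_le_zpow_right₀ hp.le (by omega)

/-- A `p`-adic integer is congruent modulo `p ^ n` to an integer in the interval `(0, p ^ n]`. -/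
theorem Padic.exists_int_pos_le_norm_sub_le {p : ℕ} [Fact p.Prime] {x : ℚ_[p]} (hx : ‖x‖ ≤ 1)
    (n : ℕ) : ∃ k : ℤ, 0 < k ∧ k ≤ (p : ℤ) ^ n ∧ ‖x - k‖ ≤ (p : ℝ) ^ (-(n : ℤ)) := by
  obtain ⟨z, rfl⟩ : ∃ z : ℤ_[p], (z : ℚ_[p]) = x := ⟨⟨x, hx⟩, rfl⟩
  refine ⟨(z - 1).appr n + 1, by positivity, ?_, ?_⟩
  · exact_mod_cast PadicInt.appr_lt (z - 1) n
  · have h := (PadicInt.norm_le_pow_iff_mem_span_pow _ n).2 (PadicInt.appr_spec n (z - 1))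
    rw [PadicInt.norm_def] at h
    convert h using 2
    push_cast
    ring

/-- the reduction algorithm, case `v_p(a) ≥ v_p(b) + r`. -/
theorem reduction_case_a_ge_b_add_r (p : ℕ) [Fact p.Prime] (r : ℕ) (hr : 1 ≤ r)
    (a b c d : ℚ_[p]) (M : Matrix (Fin 2) (Fin 2) ℚ_[p]) (hM : M = !![a, b; c, d])
    (hdet : M.det ≠ 0)
    (hint : ∀ i j, ‖M i j‖ ≤ 1) (hmin : ∃ i j, ‖M i j‖ = 1)
    (N : ℤ) (hN : vp p M.det = (N : WithTop ℤ))
    (hab : vp p b + ((r : ℤ) : WithTop ℤ) ≤ vp p a) :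
    ∃ vb : ℤ, vp p b = (vb : WithTop ℤ) ∧
      ∃ t : Matrix (Fin 2) (Fin 2) ℚ_[p], Gamma0 p r t ∧
        ∃ d' : ℤ, 0 < d' ∧ (d' : ℚ) ≤ (p : ℚ) ^ (N - vb) ∧
          M * t = !![0, (p : ℚ_[p]) ^ vb; (p : ℚ_[p]) ^ (N - vb), (d' : ℚ_[p])] := by
  have hp1 : (1 : ℝ) < p := mod_cast (Fact.out : p.Prime).one_lt
  have hp0 : (p : ℝ) ≠ 0 := by positivity
  have hpp : (p : ℚ_[p]) ≠ 0 := mod_cast (Fact.out : p.Prime).ne_zero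
  have hc : ‖c‖ ≤ 1 := by simpa [hM] using hint 1 0
  have hd : ‖d‖ ≤ 1 := by simpa [hM] using hint 1 1
  have hb : b ≠ 0 := by
    rintro rfl
    have ha : a = 0 := by
      by_contra ha
      simp [vp, ha] at hab
    simp [hM, ha] at hdet
  obtain ⟨D, hD⟩ : ∃ D, D = M.det := ⟨_, rfl⟩
  have hD' : D = a * d - b * c := by rw [hD, hM, Matrix.det_fin_two_of]
  rw [← hD] at hdet hN
  have hDn : ‖D‖ = (p : ℝ) ^ (-N) := by
    rw [Padic.norm_eq_zpow_neg_valuation hdet, (vp_eq_coe_iff.1 hN).2]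
  obtain ⟨β, hβ⟩ : ∃ β, b.valuation = β := ⟨_, rfl⟩
  have hbn : ‖b‖ = (p : ℝ) ^ (-β) := by
    rw [Padic.norm_eq_zpow_neg_valuation hb, hβ]
  have he := norm_div_le_of_vp_add_le hb hab
  have he1 : ‖a / b‖ ≤ 1 := he.trans (zpow_le_one_of_nonpos₀ hp1.le (by omega))
  have hDb : ‖D / b‖ ≤ 1 := by
    have : D / b = a / b * d - c := by rw [hD']; field_simp
    rw [this]
    refine Padic.norm_sub_le_one ?_ hc
    rw [norm_mul]
    exact mul_le_one₀ he1 (norm_nonneg _) hd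
  have hβN : 0 ≤ N - β := by
    rw [norm_div, hDn, hbn, ← zpow_sub₀ hp0, zpow_le_one_iff_right₀ hp1] at hDb
    omega
  obtain ⟨n, hn⟩ := Int.eq_ofNat_of_zero_le hβN
  have hu : ‖(p : ℚ_[p]) ^ β / b‖ = 1 := by
    rw [norm_div, Padic.norm_p_zpow, hbn, div_self (by positivity)]
  obtain ⟨k, hk0, hkn, hk⟩ := Padic.exists_int_pos_le_norm_sub_le
    (x := d * ((p : ℚ_[p]) ^ β / b)) (by rwa [norm_mul, hu, mul_one]) n
  obtain ⟨x, hx⟩ : ∃ x, x = -(b * (p : ℚ_[p]) ^ (N - β) / D) := ⟨_, rfl⟩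
  obtain ⟨y, hy⟩ : ∃ y, y = (d * ((p : ℚ_[p]) ^ β / b) - k) * (b / D) := ⟨_, rfl⟩
  have hxn : ‖x‖ = 1 := by
    rw [hx, norm_neg, norm_div, norm_mul, Padic.norm_p_zpow, hbn, hDn, ← zpow_add₀ hp0,
      ← zpow_sub₀ hp0]
    convert zpow_zero (p : ℝ) using 2
    ring
  have hyn : ‖y‖ ≤ 1 := by
    rw [hy, norm_mul, norm_div, hbn, hDn, ← zpow_sub₀ hp0]
    calc _ ≤ (p : ℝ) ^ (-(n : ℤ)) * (p : ℝ) ^ (-β - -N) := by gcongr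
      _ = 1 := by
        rw [← zpow_add₀ hp0, ← hn]
        convert zpow_zero (p : ℝ) using 2
        ring
  have hzn : ‖-(a / b * x)‖ ≤ (p : ℝ) ^ (-(r : ℤ)) := by
    rwa [norm_neg, norm_mul, hxn, mul_one]
  have hwn : ‖(p : ℚ_[p]) ^ β / b - a / b * y‖ ≤ 1 := by
    refine Padic.norm_sub_le_one hu.le ?_
    rw [norm_mul]
    exact mul_le_one₀ he1 (norm_nonneg _) hyn
  have hMt : M * !![x, y; -(a / b * x), (p : ℚ_[p]) ^ β / b - a / b * y] =
      !![0, (p : ℚ_[p]) ^ β; (p : ℚ_[p]) ^ (N - β), (k : ℚ_[p])] := by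
    have h10 : c * x - d * (a / b * x) = (p : ℚ_[p]) ^ (N - β) := by
      have : c * x - d * (a / b * x) = -(D / b) * x := by rw [hD']; field_simp; ring
      rw [this, hx]
      field_simp
    have h11 : c * y + d * ((p : ℚ_[p]) ^ β / b - a / b * y) = k := by
      have : c * y + d * ((p : ℚ_[p]) ^ β / b - a / b * y) =
          d * ((p : ℚ_[p]) ^ β / b) - D / b * y := by rw [hD']; field_simp; ring
      rw [this, hy]
      field_simp
      ring
    rw [hM, Matrix.mul_fin_two, h11, ← h10]
    congr! 3
    · field_simp; ring
    · field_simp; ring_nf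
    · ring_nf
  refine ⟨β, vp_eq_coe_iff.2 ⟨hb, hβ⟩, _, ⟨?_, ?_, ?_⟩, k, hk0, ?_, hMt⟩
  · intro i j
    fin_cases i <;> fin_cases j
    · exact hxn.le
    · exact hyn
    · exact hzn.trans (zpow_le_one_of_nonpos₀ hp1.le (by omega))
    · exact hwn
  · have h := congrArg (fun A => ‖A.det‖) hMt
    simp only [Matrix.det_mul, norm_mul] at h
    rw [← hD, hDn, Matrix.det_fin_two_of _ ((p : ℚ_[p]) ^ β), zero_mul, zero_sub, norm_neg,
      ← zpow_add₀ hpp, Padic.norm_p_zpow] at h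
    refine mul_left_cancel₀ (zpow_ne_zero (-N) hp0) (h.trans ?_)
    simp
  · exact hzn
  · rw [hn, zpow_natCast]
    exact_mod_cast hkn
end

section
/- Let p be a prime and r ≥ 2 an integer. Let M = [[a, b],[c, d]] ∈ GL₂(ℚ_p) have all entries in ℤ_p with min{v_p(a), v_p(b), v_p(c), v_p(d)} = 0, and set N = v_p(det M). If v_p(b) < v_p(a) < v_p(b) + r and v_p(c) ≤ v_p(d), then there exist t ∈ Γ₀(p^r ℤ_p) and an integer a′ with 0 < a′ ≤ p^r such that M·t = [[a′·p^{v_p(b)}, p^{v_p(b)}],[p^{N−v_p(b)}, 0]]; moreover either v_p(b) = 0 or N = v_p(b). -/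
open Matrix Classical

theorem norm_le_iff_vp_le {p : ℕ} [Fact p.Prime] {x y : ℚ_[p]} :
    ‖y‖ ≤ ‖x‖ ↔ vp p x ≤ vp p y := by
  have hp : (1 : ℝ) < p := mod_cast (Fact.out : p.Prime).one_lt
  by_cases hy : y = 0
  · simp [vp, hy]
  by_cases hx : x = 0
  · simp [vp, hx, hy]
  · simp only [vp, hx, hy, if_false, WithTop.coe_le_coe, Padic.norm_eq_zpow_neg_valuation hx,
      Padic.norm_eq_zpow_neg_valuation hy]
    rw [zpow_le_zpow_iff_right₀ hp, neg_le_neg_iff]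

theorem ne_zero_of_vp_lt {p : ℕ} [Fact p.Prime] {x : ℚ_[p]} {z : WithTop ℤ} (h : vp p x < z) :
    x ≠ 0 := by
  rintro rfl
  simp [vp] at h

theorem exists_int_norm_sub_le (p : ℕ) [Fact p.Prime] (r : ℕ) {x : ℚ_[p]} (hx : ‖x‖ ≤ 1) :
    ∃ n : ℤ, 0 < n ∧ n ≤ (p : ℤ) ^ r ∧ ‖x - n‖ ≤ (p : ℝ) ^ (-(r : ℤ)) := by
  let y : ℤ_[p] := ⟨x, hx⟩
  have hy : ‖x - (y.appr r : ℚ_[p])‖ ≤ (p : ℝ) ^ (-(r : ℤ)) := by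
    have h := (PadicInt.norm_le_pow_iff_mem_span_pow _ r).2 (PadicInt.appr_spec r y)
    rwa [PadicInt.norm_def, PadicInt.coe_sub, PadicInt.coe_natCast] at h
  rcases Nat.eq_zero_or_pos (y.appr r) with h0 | h0
  · refine ⟨(p : ℤ) ^ r, by have := (Fact.out : p.Prime).pos; positivity, le_rfl, ?_⟩
    rw [h0, Nat.cast_zero, sub_zero] at hy
    push_cast
    rw [sub_eq_add_neg]
    refine (Padic.nonarchimedean _ _).trans (max_le hy ?_)
    rw [norm_neg, Padic.norm_p_pow]
  · exact ⟨y.appr r, mod_cast h0, mod_cast (PadicInt.appr_lt y r).le, mod_cast hy⟩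

/-- the reduction algorithm, case `v_p(b) < v_p(a) < v_p(b) + r` and
`v_p(c) ≤ v_p(d)`. -/
theorem reduction_case_middle_c_le_d (p : ℕ) [Fact p.Prime] (r : ℕ) (hr : 2 ≤ r)
    (a b c d : ℚ_[p]) (M : Matrix (Fin 2) (Fin 2) ℚ_[p]) (hM : M = !![a, b; c, d])
    (hdet : M.det ≠ 0)
    (hint : ∀ i j, ‖M i j‖ ≤ 1) (hmin : ∃ i j, ‖M i j‖ = 1)
    (N : ℤ) (hN : vp p M.det = (N : WithTop ℤ))
    (hba : vp p b < vp p a) (har : vp p a < vp p b + ((r : ℤ) : WithTop ℤ))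
    (hcd : vp p c ≤ vp p d) :
    ∃ vb : ℤ, vp p b = (vb : WithTop ℤ) ∧
      (∃ t : Matrix (Fin 2) (Fin 2) ℚ_[p], Gamma0 p r t ∧
        ∃ a' : ℤ, 0 < a' ∧ a' ≤ (p : ℤ) ^ r ∧
          M * t = !![(a' : ℚ_[p]) * (p : ℚ_[p]) ^ vb, (p : ℚ_[p]) ^ vb;
                     (p : ℚ_[p]) ^ (N - vb), 0]) ∧
      (vb = 0 ∨ N = vb) := by
  subst hM
  have hb : b ≠ 0 := ne_zero_of_vp_lt hba
  have hab : ‖a‖ < ‖b‖ := by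
    rw [← not_le, norm_le_iff_vp_le]
    exact hba.not_ge
  have hdc : ‖d‖ ≤ ‖c‖ := norm_le_iff_vp_le.2 hcd
  have hc : c ≠ 0 := by
    rintro rfl
    have hd : d = 0 := by simpa using hdc
    simp [hd] at hdet
  have hbpos := norm_pos_iff.2 hb
  have hcpos := norm_pos_iff.2 hc
  have hlt : ‖a * d‖ < ‖b * c‖ := by
    rw [norm_mul, norm_mul]
    exact (mul_le_mul_of_nonneg_left hdc (norm_nonneg a)).trans_lt
      (mul_lt_mul_of_pos_right hab hcpos)
  rw [det_fin_two_of] at hdet hN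
  have hnorm : ‖a * d - b * c‖ = ‖b‖ * ‖c‖ := by
    rw [sub_eq_add_neg, Padic.add_eq_max_of_ne (by rw [norm_neg]; exact hlt.ne), norm_neg,
      max_eq_right hlt.le, norm_mul]
  have hp : (1 : ℝ) < p := mod_cast (Fact.out : p.Prime).one_lt
  have hp0 : (p : ℝ) ≠ 0 := by positivity
  have hNval : (a * d - b * c).valuation = N := by
    simpa [vp, hdet] using hN
  have hval : N = b.valuation + c.valuation := by
    rw [Padic.norm_eq_zpow_neg_valuation hdet, Padic.norm_eq_zpow_neg_valuation hb,
      Padic.norm_eq_zpow_neg_valuation hc, ← zpow_add₀ hp0, hNval] at hnorm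
    have := zpow_right_injective₀ (by positivity) hp.ne' hnorm
    omega
  refine ⟨b.valuation, by simp [vp, hb], ?_, ?_⟩
  · have hNb : N - b.valuation = c.valuation := by omega
    rw [hNb]
    have hu : ‖(p : ℚ_[p]) ^ b.valuation‖ = ‖b‖ := by
      rw [Padic.norm_p_zpow, Padic.norm_eq_zpow_neg_valuation hb]
    have hw : ‖(p : ℚ_[p]) ^ c.valuation‖ = ‖c‖ := by
      rw [Padic.norm_p_zpow, Padic.norm_eq_zpow_neg_valuation hc]
    generalize (p : ℚ_[p]) ^ b.valuation = u at hu ⊢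
    generalize (p : ℚ_[p]) ^ c.valuation = w at hw ⊢
    have hu0 : u ≠ 0 := norm_pos_iff.1 (hu ▸ hbpos)
    obtain ⟨n, hn0, hnr, hn⟩ := exists_int_norm_sub_le p r (x := a * w / (c * u)) (by
      rw [norm_div, norm_mul, norm_mul, hu, hw, div_le_one (by positivity), mul_comm]
      exact mul_le_mul_of_nonneg_left hab.le hcpos.le)
    have hn1 : ‖(n : ℚ_[p])‖ ≤ 1 := Padic.norm_int_le_one n
    set D := a * d - b * c with hD
    have hDpos : 0 < ‖D‖ := norm_pos_iff.2 hdet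
    have hdb : ‖d‖ * ‖b‖ ≤ ‖D‖ := by
      rw [hnorm, mul_comm]
      exact mul_le_mul_of_nonneg_left hdc hbpos.le
    refine ⟨!![(d * (n * u) - b * w) / D, d * u / D;
      (a * w - c * (n * u)) / D, -(c * u) / D], ⟨?_, ?_, ?_⟩, n, hn0, hnr, ?_⟩
    · have h10 : ‖a * w - c * (n * u)‖ ≤ ‖D‖ := by
        rw [sub_eq_add_neg]
        refine (Padic.nonarchimedean _ _).trans (max_le ?_ ?_)
        · rw [norm_mul, hw, hnorm]
          exact mul_le_mul_of_nonneg_right hab.le hcpos.le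
        · rw [norm_neg, norm_mul, norm_mul, hu, hnorm, mul_comm ‖b‖]
          exact mul_le_mul_of_nonneg_left (mul_le_of_le_one_left hbpos.le hn1) hcpos.le
      have h00 : ‖d * (n * u) - b * w‖ ≤ ‖D‖ := by
        rw [sub_eq_add_neg]
        refine (Padic.nonarchimedean _ _).trans (max_le ?_ ?_)
        · rw [norm_mul, norm_mul, hu]
          exact (mul_le_mul_of_nonneg_left (mul_le_of_le_one_left hbpos.le hn1)
            (norm_nonneg d)).trans hdb
        · rw [norm_neg, norm_mul, hw, hnorm]
      have h01 : ‖d * u‖ ≤ ‖D‖ := by rwa [norm_mul, hu]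
      have h11 : ‖-(c * u)‖ ≤ ‖D‖ := by rw [norm_neg, norm_mul, hu, hnorm, mul_comm]
      intro i j
      fin_cases i <;> fin_cases j <;> simpa [-norm_neg, -norm_mul, norm_div] using
        div_le_one_of_le₀ (by assumption) hDpos.le
    · have hdt : (d * (n * u) - b * w) / D * (-(c * u) / D) - d * u / D *
          ((a * w - c * (n * u)) / D) = -(u * w) / D := by
        field_simp
        rw [hD]
        ring
      rw [det_fin_two_of, hdt, norm_div, norm_neg, norm_mul, hu, hw, ← hnorm,
        div_self hDpos.ne']
    · have h : (a * w - c * (n * u)) / D = (a * w / (c * u) - n) * (c * u / D) := by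
        field_simp
      have h1 : ‖c * u / D‖ = 1 := by
        rw [norm_div, norm_mul, hu, mul_comm, ← hnorm, div_self hDpos.ne']
      simpa [-norm_mul, -norm_div, h, norm_mul _ (c * u / D), h1] using hn
    · ext i j
      fin_cases i <;> fin_cases j <;> simp [Matrix.mul_apply, Fin.sum_univ_two] <;>
        field_simp <;> rw [hD] <;> ring
  · have hb1 : ‖b‖ ≤ 1 := hint 0 1
    have hc1 : ‖c‖ ≤ 1 := hint 1 0
    have hunit : ‖b‖ = 1 ∨ ‖c‖ = 1 := by
      obtain ⟨i, j, hij⟩ := hmin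
      fin_cases i <;> fin_cases j <;> simp at hij
      · linarith
      · exact Or.inl hij
      · exact Or.inr hij
      · exact Or.inr (by linarith)
    have hval0 {x : ℚ_[p]} (hx : x ≠ 0) (h : ‖x‖ = 1) : x.valuation = 0 := by
      rw [Padic.norm_eq_zpow_neg_valuation hx, ← zpow_zero (p : ℝ)] at h
      have := zpow_right_injective₀ (by positivity) hp.ne' h
      omega
    rcases hunit with h | h
    · exact Or.inl (hval0 hb h)
    · exact Or.inr (by rw [hval, hval0 hc h, add_zero])
end

section
/- Let p be a prime and r ≥ 2 an integer. Let M = [[a, b],[c, d]] ∈ GL₂(ℚ_p) have all entries in ℤ_p with min{v_p(a), v_p(b), v_p(c), v_p(d)} = 0, and set N = v_p(det M). If v_p(b) < v_p(a) < v_p(b) + r and v_p(c) ≥ v_p(d) + r, then there exist t ∈ Γ₀(p^r ℤ_p) and an integer b′ with 0 < b′ ≤ p^{N−v_p(d)} such that M·t = [[p^{N−v_p(d)}, b′],[0, p^{v_p(d)}]]. -/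
open Matrix Classical

lemma padic_norm_sub_le_max {p : ℕ} [Fact p.Prime] (x y : ℚ_[p]) : ‖x - y‖ ≤ max ‖x‖ ‖y‖ := by
  simpa [sub_eq_add_neg] using Padic.nonarchimedean x (-y)

/-- Every `p`-adic integer is congruent modulo `p ^ k` to an integer in `(0, p ^ k]`. -/
lemma exists_pos_int_le_padic_congr (p : ℕ) [Fact p.Prime] (k : ℕ) (z : ℤ_[p]) :
    ∃ n : ℤ, 0 < n ∧ n ≤ (p : ℤ) ^ k ∧
      ∃ x : ℚ_[p], ‖x‖ ≤ 1 ∧ (p : ℚ_[p]) ^ k * x + z = n := by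
  have hp : 0 < p := (Fact.out : p.Prime).pos
  obtain ⟨y, hy⟩ := Ideal.mem_span_singleton.mp (PadicInt.appr_spec k z)
  have hlt := PadicInt.appr_lt z k
  set m := PadicInt.appr z k
  have hy' : (z : ℚ_[p]) - m = (p : ℚ_[p]) ^ k * y := by
    simpa using congrArg (fun w : ℤ_[p] => (w : ℚ_[p])) hy
  rcases Nat.eq_zero_or_pos m with h0 | hpos
  · refine ⟨(p : ℤ) ^ k, by positivity, le_rfl, ((1 - y : ℤ_[p]) : ℚ_[p]),
      PadicInt.norm_le_one _, ?_⟩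
    rw [h0] at hy'
    push_cast at hy' ⊢
    linear_combination hy'
  · refine ⟨m, by exact_mod_cast hpos, by exact_mod_cast hlt.le, ((-y : ℤ_[p]) : ℚ_[p]),
      PadicInt.norm_le_one _, ?_⟩
    push_cast
    linear_combination hy'

/-- the reduction algorithm, case `v_p(b) < v_p(a) < v_p(b) + r` and
`v_p(c) ≥ v_p(d) + r`. -/
theorem reduction_case_middle_c_ge_d_add_r (p : ℕ) [Fact p.Prime] (r : ℕ) (hr : 2 ≤ r)
    (a b c d : ℚ_[p]) (M : Matrix (Fin 2) (Fin 2) ℚ_[p]) (hM : M = !![a, b; c, d])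
    (hdet : M.det ≠ 0)
    (hint : ∀ i j, ‖M i j‖ ≤ 1) (hmin : ∃ i j, ‖M i j‖ = 1)
    (N : ℤ) (hN : vp p M.det = (N : WithTop ℤ))
    (hba : vp p b < vp p a) (har : vp p a < vp p b + ((r : ℤ) : WithTop ℤ))
    (hcd : vp p d + ((r : ℤ) : WithTop ℤ) ≤ vp p c) :
    ∃ vd : ℤ, vp p d = (vd : WithTop ℤ) ∧
      ∃ t : Matrix (Fin 2) (Fin 2) ℚ_[p], Gamma0 p r t ∧
        ∃ b' : ℤ, 0 < b' ∧ (b' : ℚ) ≤ (p : ℚ) ^ (N - vd) ∧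
          M * t = !![(p : ℚ_[p]) ^ (N - vd), (b' : ℚ_[p]); 0, (p : ℚ_[p]) ^ vd] := by
  have hpR : (1 : ℝ) < p := by exact_mod_cast (Fact.out : p.Prime).one_lt
  have hdet' : M.det = a * d - b * c := by rw [hM, Matrix.det_fin_two_of]
  have hd : d ≠ 0 := by
    rintro rfl
    have hc : c = 0 := by
      by_contra hc
      simp [vp, hc] at hcd
    exact hdet (by rw [hdet', hc]; ring)
  have hb1 : ‖b‖ ≤ 1 := by simpa [hM] using hint 0 1
  have ha1 : ‖a‖ ≤ 1 := by simpa [hM] using hint 0 0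
  have hq : ‖c / d‖ ≤ (p : ℝ) ^ (-(r : ℤ)) := by
    rcases eq_or_ne c 0 with rfl | hc
    · simp only [zero_div, norm_zero]
      positivity
    · have h : d.valuation + r ≤ c.valuation := by
        simp only [vp, hd, hc, if_false] at hcd
        exact_mod_cast hcd
      rw [norm_div, Padic.norm_eq_zpow_neg_valuation hc, Padic.norm_eq_zpow_neg_valuation hd,
        ← zpow_sub₀ (by positivity)]
      exact zpow_le_zpow_right₀ hpR.le (by lia)
  have hq1 : ‖c / d‖ ≤ 1 := hq.trans (zpow_le_one_of_nonpos₀ hpR.le (by lia))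
  have hNv : M.det.valuation = N := by
    simp only [vp, hdet, if_false] at hN
    exact_mod_cast hN
  refine ⟨d.valuation, by simp [vp, hd], ?_⟩
  set q := c / d with hqdef
  have hcq : c = q * d := by rw [hqdef]; field_simp
  set e := a - b * q with hedef
  have hde : M.det = e * d := by rw [hdet', hcq, hedef]; ring
  have he : e ≠ 0 := fun h => hdet (by rw [hde, h, zero_mul])
  have hev : e.valuation = N - d.valuation := by
    rw [← hNv, hde, Padic.valuation_mul he hd]; ring
  have he1 : ‖e‖ ≤ 1 := by
    have hbq : ‖b * q‖ ≤ 1 := by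
      rw [norm_mul]; exact mul_le_one₀ hb1 (norm_nonneg _) hq1
    exact (padic_norm_sub_le_max a (b * q)).trans (max_le ha1 hbq)
  have hunit : ∀ y : ℚ_[p], y ≠ 0 → ‖(p : ℚ_[p]) ^ y.valuation / y‖ = 1 := by
    intro y hy
    rw [norm_div, Padic.norm_p_zpow, Padic.norm_eq_zpow_neg_valuation hy]
    exact div_self (by positivity)
  obtain ⟨k, hk⟩ : ∃ k : ℕ, e.valuation = k := by
    refine Int.eq_ofNat_of_zero_le ?_
    rw [Padic.norm_eq_zpow_neg_valuation he] at he1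
    have := (zpow_le_one_iff_right₀ hpR).mp he1
    lia
  rw [← hev]
  have hα := hunit e he
  have hu := hunit d hd
  have hαe : (p : ℚ_[p]) ^ e.valuation / e * e = (p : ℚ_[p]) ^ k := by
    rw [div_mul_cancel₀ _ he, hk, zpow_natCast]
  have hud : (p : ℚ_[p]) ^ d.valuation / d * d = (p : ℚ_[p]) ^ d.valuation :=
    div_mul_cancel₀ _ hd
  set α := (p : ℚ_[p]) ^ e.valuation / e
  set u := (p : ℚ_[p]) ^ d.valuation / d
  obtain ⟨n, hn0, hnk, x, hx, hxn⟩ := exists_pos_int_le_padic_congr p k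
    ⟨b * u, by rw [norm_mul, hu, mul_one]; exact hb1⟩
  change (p : ℚ_[p]) ^ k * x + b * u = n at hxn
  refine ⟨!![α, α * x; -(q * α), u - q * α * x], ⟨?_, ?_, ?_⟩, n, hn0, ?_, ?_⟩
  · have h1 : ‖q * α * x‖ ≤ 1 := by
      rw [norm_mul, norm_mul, hα, mul_one]; exact mul_le_one₀ hq1 (norm_nonneg _) hx
    have h2 : ‖u - q * α * x‖ ≤ 1 :=
      (padic_norm_sub_le_max _ _).trans (max_le hu.le h1)
    intro i j
    fin_cases i <;> fin_cases j <;> simp [hα, hx, hq1, h2]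
  · rw [Matrix.det_fin_two_of,
      show α * (u - q * α * x) - α * x * -(q * α) = α * u by ring, norm_mul, hα, hu, mul_one]
  · simpa [hα] using hq
  · rw [hk, zpow_natCast]
    exact_mod_cast hnk
  · rw [hk, zpow_natCast, ← hud, ← hxn, ← hαe, hM, hcq, hedef]
    ext i j
    fin_cases i <;> fin_cases j <;> simp [Matrix.mul_apply, Fin.sum_univ_two] <;> ring
end
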